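/- arXiv:2309.06427 — 3 statements merged into one kernel-verified Lean document; each statement's English description precedes it below -/
import Mathlib

section
/- Let S be a symmetric block tridiagonal matrix all of whose diagonal blocks are invertible, with stair splittings S = Ψl − Pl = Ψr − Pr. If (λ, u) is an eigenpair of Ψr⁻¹ * Pr with λ ≠ 0, then λ • u_e + u_o ≠ 0 and (λ, λ • u_e + u_o) is an eigenpair of Ψl⁻¹ * Pl. -/
open Matrix

namespace StairPrecond

/-- Real matrices indexed as n×n arrays of m×m blocks. -/
abbrev Mat (n m : ℕ) := Matrix (Fin n × Fin m) (Fin n × Fin m) ℝ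

/-- Vectors compatible with `Mat n m`. -/
abbrev Vec (n m : ℕ) := Fin n × Fin m → ℝ

/-- The (i,j)-block of a block matrix. -/
def blockOf {n m : ℕ} (M : Mat n m) (i j : Fin n) : Matrix (Fin m) (Fin m) ℝ :=
  fun a b => M (i, a) (j, b)

/-- A matrix is block tridiagonal if its (i,j)-block vanishes whenever |i - j| > 1. -/
def IsBlockTridiag {n m : ℕ} (M : Mat n m) : Prop :=
  ∀ i j : Fin n, (i.val + 1 < j.val ∨ j.val + 1 < i.val) → blockOf M i j = 0

/-- The block-diagonal part `D` of a matrix: keep only the diagonal blocks. -/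
def blockDiagPart {n m : ℕ} (M : Mat n m) : Mat n m :=
  fun p q => if p.1 = q.1 then M p q else 0

/-- The left stair Ψl: diagonal blocks everywhere, off-diagonal blocks only in
block rows of odd index (0-indexed). -/
def stairL {n m : ℕ} (M : Mat n m) : Mat n m :=
  fun p q =>
    if p.1 = q.1 ∨ (Odd p.1.val ∧ (p.1.val = q.1.val + 1 ∨ q.1.val = p.1.val + 1)) then M p q
    else 0

/-- The right stair Ψr: diagonal blocks everywhere, off-diagonal blocks only in
block rows of even index (0-indexed). -/
def stairR {n m : ℕ} (M : Mat n m) : Mat n m :=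
  fun p q =>
    if p.1 = q.1 ∨ (Even p.1.val ∧ (p.1.val = q.1.val + 1 ∨ q.1.val = p.1.val + 1)) then M p q
    else 0

/-- Pl = Ψl − S. -/
def Pl {n m : ℕ} (S : Mat n m) : Mat n m := stairL S - S

/-- Pr = Ψr − S. -/
def Pr {n m : ℕ} (S : Mat n m) : Mat n m := stairR S - S

/-- The additive stair preconditioner Φadd⁻¹ = (1/2) • (Ψl⁻¹ + Ψr⁻¹). -/
noncomputable def Phiadd {n m : ℕ} (S : Mat n m) : Mat n m :=
  (1 / 2 : ℝ) • ((stairL S)⁻¹ + (stairR S)⁻¹)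

/-- The symmetric stair preconditioner Φsym⁻¹ = Ψl⁻¹ + Ψr⁻¹ − D⁻¹. -/
noncomputable def Phisym {n m : ℕ} (S : Mat n m) : Mat n m :=
  (stairL S)⁻¹ + (stairR S)⁻¹ - (blockDiagPart S)⁻¹

/-- All diagonal blocks are invertible m×m matrices. -/
def DiagBlocksInvertible {n m : ℕ} (M : Mat n m) : Prop :=
  ∀ i : Fin n, IsUnit (blockOf M i i)

/-- v_e : the part of v supported on blocks of odd index (0-indexed). -/
def vE {n m : ℕ} (v : Vec n m) : Vec n m := fun p => if Odd p.1.val then v p else 0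

/-- v_o : the part of v supported on blocks of even index (0-indexed). -/
def vO {n m : ℕ} (v : Vec n m) : Vec n m := fun p => if Even p.1.val then v p else 0

/-- A stair matrix: block tridiagonal, with off-diagonal blocks nonzero only in
block rows of a fixed parity (a left stair has them only in odd-indexed rows,
a right stair only in even-indexed rows, 0-indexed). -/
def IsStairMatrix {n m : ℕ} (Ψ : Mat n m) : Prop :=
  IsBlockTridiag Ψ ∧
    ((∀ i j : Fin n, i ≠ j → Even i.val → blockOf Ψ i j = 0) ∨
     (∀ i j : Fin n, i ≠ j → Odd i.val → blockOf Ψ i j = 0))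

/-- Entrywise, the left stair of a block tridiagonal matrix is the matrix itself on odd block rows
and its block diagonal part on even block rows. -/
lemma stairL_apply {n m : ℕ} {S : Mat n m} (htri : IsBlockTridiag S) (p q : Fin n × Fin m) :
    stairL S p q = if Odd p.1.val then S p q else blockDiagPart S p q := by
  have h : p.1.val + 1 < q.1.val ∨ q.1.val + 1 < p.1.val → S p q = 0 :=
    fun hpq => congrFun (congrFun (htri p.1 q.1 hpq) p.2) q.2
  simp only [stairL, blockDiagPart, Fin.ext_iff]
  split_ifs <;> first | rfl | (exfalso; tauto) | exact (h (by grind)).symm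

/-- Entrywise, the right stair of a block tridiagonal matrix is the matrix itself on even block rows
and its block diagonal part on odd block rows. -/
lemma stairR_apply {n m : ℕ} {S : Mat n m} (htri : IsBlockTridiag S) (p q : Fin n × Fin m) :
    stairR S p q = if Even p.1.val then S p q else blockDiagPart S p q := by
  have h : p.1.val + 1 < q.1.val ∨ q.1.val + 1 < p.1.val → S p q = 0 :=
    fun hpq => congrFun (congrFun (htri p.1 q.1 hpq) p.2) q.2
  simp only [stairR, blockDiagPart, Fin.ext_iff]
  split_ifs <;> first | rfl | (exfalso; tauto) | exact (h (by grind)).symm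

lemma stairL_mulVec_apply {n m : ℕ} {S : Mat n m} (htri : IsBlockTridiag S) (v : Vec n m)
    (p : Fin n × Fin m) :
    (stairL S *ᵥ v) p =
      if Odd p.1.val then (S *ᵥ v) p else (blockDiagPart S *ᵥ v) p := by
  simp only [mulVec, dotProduct, stairL_apply htri]
  split_ifs <;> rfl

lemma stairR_mulVec_apply {n m : ℕ} {S : Mat n m} (htri : IsBlockTridiag S) (v : Vec n m)
    (p : Fin n × Fin m) :
    (stairR S *ᵥ v) p =
      if Even p.1.val then (S *ᵥ v) p else (blockDiagPart S *ᵥ v) p := by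
  simp only [mulVec, dotProduct, stairR_apply htri]
  split_ifs <;> rfl

/-- If only the diagonal block contributes to row `p` of `M *ᵥ v`, that entry is computed by the
diagonal block. -/
lemma mulVec_apply_eq_blockOf_mulVec {n m : ℕ} (M : Mat n m) (v : Vec n m) (i : Fin n) (a : Fin m)
    (h : ∀ q : Fin n × Fin m, q.1 ≠ i → M (i, a) q * v q = 0) :
    (M *ᵥ v) (i, a) = (blockOf M i i *ᵥ fun b => v (i, b)) a := by
  simp only [mulVec, dotProduct, blockOf, Fintype.sum_prod_type]
  exact Finset.sum_eq_single i
    (fun j _ hj => Finset.sum_eq_zero fun b _ => h (j, b) hj) (by simp)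

/-- A block matrix with invertible diagonal blocks is invertible if its off-diagonal blocks couple
only rows satisfying `P` to columns not satisfying `P`. -/
lemma isUnit_of_offDiag_eq_zero {n m : ℕ} {M : Mat n m} (hdiag : DiagBlocksInvertible M)
    (P : Fin n → Prop)
    (h : ∀ p q : Fin n × Fin m, p.1 ≠ q.1 → ¬(P p.1 ∧ ¬P q.1) → M p q = 0) :
    IsUnit M := by
  rw [← mulVec_injective_iff_isUnit, ← coe_mulVecLin, injective_iff_map_eq_zero]
  intro v hv
  have hblock : ∀ i : Fin n,
      (∀ (a : Fin m) (q : Fin n × Fin m), q.1 ≠ i → M (i, a) q * v q = 0) →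
        ∀ b, v (i, b) = 0 := by
    intro i hi
    refine congrFun (mulVec_injective_iff_isUnit.mpr (hdiag i) ?_ : (fun b => v (i, b)) = 0)
    rw [mulVec_zero]
    ext a
    rw [← mulVec_apply_eq_blockOf_mulVec M v i a (hi a)]
    exact congrFun hv (i, a)
  have hnot : ∀ i, ¬P i → ∀ b, v (i, b) = 0 := fun i hi =>
    hblock i fun a q hq => by rw [h (i, a) q hq.symm fun hc => hi hc.1, zero_mul]
  ext ⟨i, b⟩
  refine hblock i (fun a q hq => ?_) b
  by_cases hPq : P q.1
  · rw [h (i, a) q hq.symm fun hc => hc.2 hPq, zero_mul]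
  · rw [show v q = 0 from hnot q.1 hPq q.2, mul_zero]

lemma isUnit_stairL {n m : ℕ} {S : Mat n m} (hdiag : DiagBlocksInvertible S) :
    IsUnit (stairL S) := by
  refine isUnit_of_offDiag_eq_zero (fun i => ?_) (fun i => Odd i.val) fun p q hpq h => ?_
  · convert hdiag i using 1
    ext a b
    simp [blockOf, stairL]
  · exact if_neg (by grind)

lemma isUnit_stairR {n m : ℕ} {S : Mat n m} (hdiag : DiagBlocksInvertible S) :
    IsUnit (stairR S) := by
  refine isUnit_of_offDiag_eq_zero (fun i => ?_) (fun i => Even i.val) fun p q hpq h => ?_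
  · convert hdiag i using 1
    ext a b
    simp [blockOf, stairR]
  · exact if_neg (by grind)

/-- For invertible `A`, eigenpairs of `A⁻¹ * B` are generalized eigenpairs of `(B, A)`. -/
lemma inv_mul_mulVec_eq_smul_iff {ι : Type*} [Fintype ι] [DecidableEq ι] {A B : Matrix ι ι ℝ}
    (hA : IsUnit A) (c : ℝ) (v : ι → ℝ) :
    (A⁻¹ * B) *ᵥ v = c • v ↔ B *ᵥ v = c • (A *ᵥ v) := by
  have hdet := (isUnit_iff_isUnit_det A).mp hA
  rw [← (mulVec_injective_iff_isUnit.mpr hA).eq_iff, mulVec_mulVec, ← Matrix.mul_assoc,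
    mul_nonsing_inv A hdet, Matrix.one_mul, mulVec_smul]

lemma smul_vE_add_vO_apply {n m : ℕ} (c : ℝ) (u : Vec n m) (p : Fin n × Fin m) :
    (c • vE u + vO u) p = (if Odd p.1.val then c else 1) * u p := by
  by_cases hp : Odd p.1.val
  · simp [vE, vO, hp, Nat.not_even_iff_odd.mpr hp]
  · simp [vE, vO, hp, Nat.not_odd_iff_even.mp hp]

lemma blockDiagPart_mulVec_smul_vE_add_vO {n m : ℕ} (S : Mat n m) (c : ℝ) (u : Vec n m)
    (p : Fin n × Fin m) :
    (blockDiagPart S *ᵥ (c • vE u + vO u)) p =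
      (if Odd p.1.val then c else 1) * (blockDiagPart S *ᵥ u) p := by
  simp only [mulVec, dotProduct, Finset.mul_sum, smul_vE_add_vO_apply]
  refine Finset.sum_congr rfl fun q _ => ?_
  by_cases hpq : p.1 = q.1
  · rw [hpq]; ring
  · simp [blockDiagPart, hpq]

lemma offDiag_mulVec_smul_vE_add_vO {n m : ℕ} {S : Mat n m} (htri : IsBlockTridiag S) (c : ℝ)
    (u : Vec n m) (p : Fin n × Fin m) :
    ((S - blockDiagPart S) *ᵥ (c • vE u + vO u)) p =
      (if Odd p.1.val then 1 else c) * ((S - blockDiagPart S) *ᵥ u) p := by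
  simp only [mulVec, dotProduct, Finset.mul_sum, smul_vE_add_vO_apply]
  refine Finset.sum_congr rfl fun q _ => ?_
  by_cases hpq : p.1 = q.1
  · simp [blockDiagPart, hpq]
  by_cases hfar : p.1.val + 1 < q.1.val ∨ q.1.val + 1 < p.1.val
  · have h : S p q = 0 := congrFun (congrFun (htri p.1 q.1 hfar) p.2) q.2
    simp [blockDiagPart, hpq, h]
  · have hne : p.1.val ≠ q.1.val := fun h => hpq (Fin.ext h)
    have hpar : Odd q.1.val ↔ ¬Odd p.1.val := by grind
    by_cases hp : Odd p.1.val
    · simp [hpar, hp]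
    · simp only [hpar, hp, not_false_eq_true, if_true, if_false]
      ring

/-- If (λ, u) is an eigenpair of Ψr⁻¹ * Pr with λ ≠ 0, then
(λ, λ • u_e + u_o) is an eigenpair of Ψl⁻¹ * Pl. -/
theorem eigenpair_right_to_left {n m : ℕ} (hn : 0 < n) (hm : 0 < m)
    (S : Mat n m) (hsymm : S.IsSymm) (htri : IsBlockTridiag S)
    (hdiag : DiagBlocksInvertible S)
    (lam : ℝ) (u : Vec n m) (hu : u ≠ 0)
    (heig : ((stairR S)⁻¹ * Pr S) *ᵥ u = lam • u) (hlam : lam ≠ 0) :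
    lam • vE u + vO u ≠ 0 ∧
      ((stairL S)⁻¹ * Pl S) *ᵥ (lam • vE u + vO u) = lam • (lam • vE u + vO u) := by
  have hr := (inv_mul_mulVec_eq_smul_iff (isUnit_stairR hdiag) lam u).mp heig
  refine ⟨fun h0 => hu ?_,
    (inv_mul_mulVec_eq_smul_iff (isUnit_stairL hdiag) lam _).mpr ?_⟩
  · ext p
    have hp := congrFun h0 p
    rw [smul_vE_add_vO_apply] at hp
    refine (mul_eq_zero.mp hp).resolve_left ?_
    split_ifs
    exacts [hlam, one_ne_zero]
  · ext p
    have hp := congrFun hr p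
    have hD := blockDiagPart_mulVec_smul_vE_add_vO S lam u p
    have hO := offDiag_mulVec_smul_vE_add_vO htri lam u p
    simp only [Pr, Pl, sub_mulVec, Pi.sub_apply, Pi.smul_apply, smul_eq_mul,
      stairR_mulVec_apply htri, stairL_mulVec_apply htri] at hp hO ⊢
    by_cases hodd : Odd p.1.val
    · simp only [hodd, Nat.not_even_iff_odd.mpr hodd, if_true, if_false] at hp hD hO ⊢
      linear_combination lam * hp - lam * hO - lam * hD
    · simp only [hodd, Nat.not_odd_iff_even.mp hodd, if_true, if_false] at hp hD hO ⊢
      linear_combination hp - hO - lam * hD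

end StairPrecond
end

section
/- If S is a symmetric block tridiagonal matrix that is positive definite, then every complex eigenvalue of Φadd⁻¹ * S (every root of the characteristic polynomial of Φadd⁻¹ * S over ℂ) is a real number and is strictly positive. -/
open Matrix

namespace StairPrecond

open scoped ComplexOrder MatrixOrder in
theorem _root_.Matrix.PosDef.map_ofReal {ι : Type*} [Fintype ι] [DecidableEq ι]
    {A : Matrix ι ι ℝ} (hA : A.PosDef) : (A.map (fun x => (x : ℂ))).PosDef := by
  obtain ⟨B, hB⟩ := CStarAlgebra.nonneg_iff_eq_star_mul_self.mp hA.posSemidef.nonneg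
  have hmap : A.map (fun x => (x : ℂ)) =
      (B.map (fun x => (x : ℂ)))ᴴ * B.map (fun x => (x : ℂ)) := by
    rw [hB]
    ext i j
    simp [Matrix.mul_apply, Matrix.star_eq_conjTranspose]
  have hpsd : (A.map (fun x => (x : ℂ))).PosSemidef := by
    rw [hmap]
    exact Matrix.posSemidef_conjTranspose_mul_self _
  exact hpsd.posDef_iff_isUnit.mpr (hA.isUnit.map (Complex.ofRealHom.mapMatrix (m := ι)))

open scoped ComplexOrder in
/-- The eigenvalues of a product of two positive definite matrices are positive reals. -/
theorem _root_.Matrix.PosDef.pos_of_isRoot_charpoly_mul {ι : Type*} [Fintype ι] [DecidableEq ι]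
    {A B : Matrix ι ι ℂ} (hA : A.PosDef) (hB : B.PosDef) {μ : ℂ}
    (hμ : (A * B).charpoly.IsRoot μ) : 0 < μ := by
  obtain ⟨v, hv, hvμ⟩ : ∃ v ≠ 0, (A * B) *ᵥ v = μ • v := by
    rw [Polynomial.IsRoot, Matrix.eval_charpoly, ← Matrix.exists_mulVec_eq_zero_iff] at hμ
    obtain ⟨v, hv, h⟩ := hμ
    refine ⟨v, hv, ?_⟩
    rw [Matrix.sub_mulVec, sub_eq_zero] at h
    rw [← h]
    ext i
    simp [Matrix.scalar_apply, Matrix.mulVec_diagonal]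
  have hBv := hB.dotProduct_mulVec_pos hv
  have hne : B *ᵥ v ≠ 0 := by
    intro h
    simp [h] at hBv
  have hABv := hA.dotProduct_mulVec_pos hne
  have heq : star (B *ᵥ v) ⬝ᵥ (A *ᵥ (B *ᵥ v)) = μ * (star v ⬝ᵥ (B *ᵥ v)) := by
    rw [Matrix.mulVec_mulVec, hvμ, dotProduct_smul, Matrix.star_mulVec, hB.isHermitian.eq,
      ← Matrix.dotProduct_mulVec, smul_eq_mul]
  rw [heq] at hABv
  exact (mul_pos_iff_of_pos_right hBv).mp hABv

/-- If `U` is strictly off-diagonal for the grading given by an involution `J` commuting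
with `D`, then `U * D⁻¹ * U = 0` and the inverse of `D + U` is given by a
truncated Neumann series. -/
theorem inv_add_of_grading {ι : Type*} [Fintype ι] [DecidableEq ι] {J D U : Matrix ι ι ℝ}
    (hD : IsUnit D) (hJD : J * D = D * J) (hJU : J * U = U) (hUJ : U * J = -U) :
    (D + U)⁻¹ = D⁻¹ - D⁻¹ * U * D⁻¹ := by
  have hdet := (Matrix.isUnit_iff_isUnit_det D).mp hD
  have hJD' : J * D⁻¹ = D⁻¹ * J := by
    calc J * D⁻¹ = D⁻¹ * (D * J) * D⁻¹ := by
          rw [← Matrix.mul_assoc, Matrix.nonsing_inv_mul _ hdet, Matrix.one_mul]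
      _ = D⁻¹ * J := by
          rw [← hJD, Matrix.mul_assoc, Matrix.mul_assoc, Matrix.mul_nonsing_inv _ hdet,
            Matrix.mul_one]
  have hzero : U * D⁻¹ * U = 0 := by
    have h : U * D⁻¹ * U = -(U * D⁻¹ * U) := by
      calc U * D⁻¹ * U = U * (D⁻¹ * J) * U := by rw [Matrix.mul_assoc, Matrix.mul_assoc,
            Matrix.mul_assoc, hJU]
        _ = (U * J) * D⁻¹ * U := by rw [← hJD']; simp only [Matrix.mul_assoc]
        _ = -(U * D⁻¹ * U) := by rw [hUJ]; simp
    ext i j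
    exact self_eq_neg.mp (congrFun (congrFun h i) j)
  apply Matrix.inv_eq_right_inv
  calc (D + U) * (D⁻¹ - D⁻¹ * U * D⁻¹)
      = D * D⁻¹ - (D * D⁻¹) * U * D⁻¹ + U * D⁻¹ - (U * D⁻¹ * U) * D⁻¹ := by noncomm_ring
    _ = 1 := by rw [hzero, Matrix.mul_nonsing_inv _ hdet]; simp

/-- The signature matrix: `1` on block rows of odd index and `-1` on those of even index. -/
def signature (n m : ℕ) : Mat n m := diagonal fun p => if Odd p.1.val then 1 else -1

theorem signature_mul_self (n m : ℕ) : signature n m * signature n m = 1 := by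
  rw [signature, diagonal_mul_diagonal, ← diagonal_one]
  congr 1
  ext p
  split_ifs <;> norm_num

theorem signature_mul_blockDiagPart {n m : ℕ} (S : Mat n m) :
    signature n m * blockDiagPart S = blockDiagPart S * signature n m := by
  ext p q
  rw [signature, diagonal_mul, mul_diagonal, mul_comm]
  by_cases h : p.1 = q.1 <;> simp [blockDiagPart, h]

theorem signature_conj {n m : ℕ} {S : Mat n m} (htri : IsBlockTridiag S) :
    signature n m * S * signature n m = (2 : ℝ) • blockDiagPart S - S := by
  ext p q
  have hz : (p.1.val + 1 < q.1.val ∨ q.1.val + 1 < p.1.val) → S p q = 0 := fun h =>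
    congrFun (congrFun (htri p.1 q.1 h) p.2) q.2
  simp only [signature, diagonal_mul, mul_diagonal, blockDiagPart, Matrix.sub_apply, Matrix.smul_apply,
    smul_eq_mul, Fin.ext_iff]
  grind

theorem signature_stairL_sub {n m : ℕ} (S : Mat n m) :
    signature n m * (stairL S - blockDiagPart S) = stairL S - blockDiagPart S ∧
      (stairL S - blockDiagPart S) * signature n m = -(stairL S - blockDiagPart S) := by
  constructor <;> ext p q <;>
  simp only [signature, diagonal_mul, mul_diagonal, blockDiagPart, stairL, Matrix.sub_apply, Matrix.neg_apply,
    Fin.ext_iff] <;> grind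

theorem signature_stairR_sub {n m : ℕ} (S : Mat n m) :
    -signature n m * (stairR S - blockDiagPart S) = stairR S - blockDiagPart S ∧
      (stairR S - blockDiagPart S) * -signature n m = -(stairR S - blockDiagPart S) := by
  constructor <;> ext p q <;>
  simp only [signature, diagonal_mul, mul_diagonal, blockDiagPart, stairR, Matrix.sub_apply, Matrix.neg_apply,
    Matrix.neg_mul, Matrix.mul_neg, Fin.ext_iff] <;> grind

theorem stairL_add_stairR {n m : ℕ} {S : Mat n m} (htri : IsBlockTridiag S) :
    stairL S + stairR S = blockDiagPart S + S := by
  ext p q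
  have hz : (p.1.val + 1 < q.1.val ∨ q.1.val + 1 < p.1.val) → S p q = 0 := fun h =>
    congrFun (congrFun (htri p.1 q.1 h) p.2) q.2
  simp only [blockDiagPart, stairL, stairR, Matrix.add_apply, Fin.ext_iff]
  grind

theorem posDef_signature_conj {n m : ℕ} {S : Mat n m} (hpd : S.PosDef) :
    (signature n m * S * signature n m).PosDef := by
  have h : (signature n m)ᴴ = signature n m := by
    simp [signature]
  have hu : IsUnit (signature n m) := IsUnit.of_mul_eq_one _ (signature_mul_self n m)
  have := hpd.conjTranspose_mul_mul_same (Matrix.mulVec_injective_of_isUnit hu)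
  rwa [h] at this

theorem posDef_blockDiagPart {n m : ℕ} {S : Mat n m} (htri : IsBlockTridiag S)
    (hpd : S.PosDef) : (blockDiagPart S).PosDef := by
  have h : blockDiagPart S = (1 / 2 : ℝ) • (S + signature n m * S * signature n m) := by
    rw [signature_conj htri]
    module
  rw [h]
  exact (hpd.add (posDef_signature_conj hpd)).smul (by norm_num)

theorem posDef_Phiadd {n m : ℕ} {S : Mat n m} (htri : IsBlockTridiag S)
    (hpd : S.PosDef) : (Phiadd S).PosDef := by
  have hD := posDef_blockDiagPart htri hpd
  have hdet := (Matrix.isUnit_iff_isUnit_det _).mp hD.isUnit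
  have hJD := signature_mul_blockDiagPart S
  have hL := inv_add_of_grading hD.isUnit hJD (signature_stairL_sub S).1 (signature_stairL_sub S).2
  have hR := inv_add_of_grading hD.isUnit (by simpa using hJD) (signature_stairR_sub S).1 (signature_stairR_sub S).2
  rw [add_sub_cancel] at hL hR
  have hPhi : Phiadd S = (1 / 2 : ℝ) • ((blockDiagPart S)⁻¹ +
      (blockDiagPart S)⁻¹ * (signature n m * S * signature n m) * (blockDiagPart S)⁻¹) := by
    rw [Phiadd, hL, hR, signature_conj htri]
    have hS : S = stairL S + stairR S - blockDiagPart S := by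
      rw [stairL_add_stairR htri, add_sub_cancel_left]
    generalize blockDiagPart S = D at *
    generalize stairL S = L at *
    generalize stairR S = R at *
    subst hS
    simp only [Matrix.mul_sub, Matrix.sub_mul, Matrix.mul_add, Matrix.add_mul, Matrix.mul_smul,
      Matrix.smul_mul, Matrix.nonsing_inv_mul _ hdet, Matrix.one_mul]
    module
  rw [hPhi]
  refine (hD.inv.add ?_).smul (by norm_num)
  have hinj := Matrix.mulVec_injective_of_isUnit hD.inv.isUnit
  have := (posDef_signature_conj hpd).conjTranspose_mul_mul_same hinj
  rwa [hD.inv.isHermitian.eq] at this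

/-- If S is symmetric block tridiagonal positive definite, then every complex
eigenvalue of Φadd⁻¹ * S is real and strictly positive. -/
theorem add_eigenvalues_real_pos {n m : ℕ} (hn : 0 < n) (hm : 0 < m)
    (S : Mat n m) (htri : IsBlockTridiag S) (hpd : S.PosDef) :
    ∀ μ : ℂ, (Matrix.charpoly ((Phiadd S * S).map (fun x => (x : ℂ)))).IsRoot μ →
      μ.im = 0 ∧ 0 < μ.re := by
  intro μ hμ
  have hmap : (Phiadd S * S).map (fun x => (x : ℂ)) =
      (Phiadd S).map (fun x => (x : ℂ)) * S.map (fun x => (x : ℂ)) :=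
    Matrix.map_mul (f := Complex.ofRealHom)
  rw [hmap] at hμ
  open scoped ComplexOrder in
  have hpos := (posDef_Phiadd htri hpd).map_ofReal.pos_of_isRoot_charpoly_mul hpd.map_ofReal hμ
  obtain ⟨hre, him⟩ := Complex.pos_iff.mp hpos
  exact ⟨him.symm, hre⟩

end StairPrecond
end

section
/- If S is a symmetric block tridiagonal matrix that is positive definite, then every complex eigenvalue of Φadd⁻¹ * S is real and lies in the half-open interval (0, 9/8]. -/
open Matrix

namespace StairPrecond

section Core

open scoped ComplexOrder

variable {ι : Type*} [Fintype ι]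

/-- The entrywise complexification of a real positive definite matrix is positive definite. -/
theorem posDef_map_ofReal {M : Matrix ι ι ℝ} (hM : M.PosDef) :
    (M.map (fun x => (x : ℂ))).PosDef := by
  have hH : (M.map (fun x => (x : ℂ))).IsHermitian :=
    hM.isHermitian.map _ fun x => by simp
  refine PosDef.of_dotProduct_mulVec_pos hH fun v hv => ?_
  rw [Complex.pos_iff]
  refine ⟨?_, (hH.im_star_dotProduct_mulVec_self v).symm⟩
  have hre : (star v ⬝ᵥ (M.map (fun x => (x : ℂ))) *ᵥ v).re =
      (star (fun i => (v i).re) ⬝ᵥ M *ᵥ (fun i => (v i).re)) +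
      (star (fun i => (v i).im) ⬝ᵥ M *ᵥ (fun i => (v i).im)) := by
    simp only [dotProduct, mulVec, Finset.mul_sum, Complex.re_sum, ← Finset.sum_add_distrib]
    refine Finset.sum_congr rfl fun i _ => Finset.sum_congr rfl fun j _ => ?_
    simp
  rw [hre]
  by_cases hx : (fun i => (v i).re) = 0
  · have hy : (fun i => (v i).im) ≠ 0 := fun hy =>
      hv (funext fun i => Complex.ext (congrFun hx i) (congrFun hy i))
    exact add_pos_of_nonneg_of_pos (hM.posSemidef.dotProduct_mulVec_nonneg _)
      (hM.dotProduct_mulVec_pos hy)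
  · exact add_pos_of_pos_of_nonneg (hM.dotProduct_mulVec_pos hx)
      (hM.posSemidef.dotProduct_mulVec_nonneg _)

variable [DecidableEq ι]

/-- If `D + N` and `D - N` are positive definite, the eigenvalues of `D⁻¹ * N` are real and
of absolute value less than one. -/
theorem eigenvalue_inv_mul_of_posDef {D N : Matrix ι ι ℝ} (hD : IsUnit D)
    (hadd : (D + N).PosDef) (hsub : (D - N).PosDef) {k : ℂ}
    (hk : k ∈ spectrum ℂ ((D⁻¹ * N).map (fun x => (x : ℂ)))) :
    ∃ r : ℝ, k = r ∧ -1 < r ∧ r < 1 := by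
  rw [← Matrix.spectrum_toLin', ← Module.End.hasEigenvalue_iff_mem_spectrum] at hk
  obtain ⟨v, hv⟩ := hk.exists_hasEigenvector
  have hv0 := hv.2
  have hKv : (D⁻¹ * N).map (fun x => (x : ℂ)) *ᵥ v = k • v := by
    simpa using hv.apply_eq_smul
  have hmap : N.map (fun x => (x : ℂ)) =
      D.map (fun x => (x : ℂ)) * (D⁻¹ * N).map (fun x => (x : ℂ)) := by
    have h := Matrix.map_mul (L := D) (M := D⁻¹ * N) (f := Complex.ofRealHom)
    rw [Matrix.mul_nonsing_inv_cancel_left _ _ ((Matrix.isUnit_iff_isUnit_det D).1 hD)] at h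
    exact h
  have hNv : N.map (fun x => (x : ℂ)) *ᵥ v = k • (D.map (fun x => (x : ℂ)) *ᵥ v) := by
    rw [hmap, ← mulVec_mulVec, hKv, mulVec_smul]
  set a : ℂ := star v ⬝ᵥ D.map (fun x => (x : ℂ)) *ᵥ v with ha
  have h1 := (posDef_map_ofReal hadd).dotProduct_mulVec_pos hv0
  have h2 := (posDef_map_ofReal hsub).dotProduct_mulVec_pos hv0
  rw [Matrix.map_add _ (by simp), add_mulVec, hNv, dotProduct_add, dotProduct_smul, ← ha,
    smul_eq_mul, Complex.pos_iff] at h1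
  rw [Matrix.map_sub _ (by simp), sub_mulVec, hNv, dotProduct_sub, dotProduct_smul, ← ha,
    smul_eq_mul, Complex.pos_iff] at h2
  simp only [Complex.add_re, Complex.add_im, Complex.sub_re, Complex.sub_im, Complex.mul_re,
    Complex.mul_im] at h1 h2
  obtain ⟨h1r, h1i⟩ := h1
  obtain ⟨h2r, h2i⟩ := h2
  have hai : a.im = 0 := by linarith
  rw [hai] at h1r h1i h2r h2i
  have har : 0 < a.re := by linarith
  have hki : k.im = 0 := by
    have : k.im * a.re = 0 := by linarith
    exact (mul_eq_zero.1 this).resolve_right har.ne'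
  exact ⟨k.re, Complex.ext rfl (by simpa using hki), by nlinarith, by nlinarith⟩

open Polynomial in
/-- Spectral bound for the quadratic `(1 - K / 2) * (1 + K)` in `K = D⁻¹ * N`. -/
theorem eigenvalue_quadratic_of_posDef {D N : Matrix ι ι ℝ} (hD : IsUnit D)
    (hadd : (D + N).PosDef) (hsub : (D - N).PosDef) {μ : ℂ}
    (hμ : μ ∈ spectrum ℂ
      (((1 - (1 / 2 : ℝ) • (D⁻¹ * N)) * (1 + D⁻¹ * N)).map (fun x => (x : ℂ)))) :
    μ.im = 0 ∧ 0 < μ.re ∧ μ.re ≤ 9 / 8 := by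
  set K := D⁻¹ * N with hK
  have hpoly : ((1 - (1 / 2 : ℝ) • K) * (1 + K)).map (fun x => (x : ℂ)) =
      aeval (K.map (fun x => (x : ℂ)))
        (C (-1 / 2) * X ^ 2 + C (1 / 2) * X + C 1 : ℂ[X]) := by
    have hreal : (1 - (1 / 2 : ℝ) • K) * (1 + K) =
        (-1 / 2 : ℝ) • (K * K) + (1 / 2 : ℝ) • K + 1 := by
      simp only [sub_mul, mul_add, one_mul, mul_one, Matrix.smul_mul]
      module
    have hsq : (K * K).map (fun x => (x : ℂ)) =
        K.map (fun x => (x : ℂ)) * K.map (fun x => (x : ℂ)) :=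
      Matrix.map_mul (f := Complex.ofRealHom)
    rw [hreal]
    simp only [map_add, map_mul, aeval_C, aeval_X, sq, ← hsq,
      ← Algebra.smul_def, map_one]
    ext i j
    by_cases hij : i = j <;> simp [hij]
  rw [hpoly, spectrum.map_polynomial_aeval_of_degree_pos _ _ (by
    rw [degree_quadratic (by norm_num)]; norm_num)] at hμ
  obtain ⟨k, hk, rfl⟩ := hμ
  obtain ⟨r, rfl, hr1, hr2⟩ := eigenvalue_inv_mul_of_posDef hD hadd hsub hk
  have hval : eval (r : ℂ) (C (-1 / 2) * X ^ 2 + C (1 / 2) * X + C 1 : ℂ[X]) =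
      ((-1 / 2 * r ^ 2 + 1 / 2 * r + 1 : ℝ) : ℂ) := by
    simp
  simp only [hval, Complex.ofReal_im, Complex.ofReal_re, true_and]
  exact ⟨by nlinarith, by nlinarith [sq_nonneg (r - 1 / 2)]⟩

/-- If `J` commutes with `D` and `J * A = -A`, `A * J = A`, then `(D + A)⁻¹` is given by the
two-term Neumann series. -/
theorem inv_add_of_parity {D A J : Matrix ι ι ℝ} (hD : IsUnit D) (hJD : J * D = D * J)
    (hJA : J * A = -A) (hAJ : A * J = A) :
    (D + A)⁻¹ = D⁻¹ - D⁻¹ * A * D⁻¹ := by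
  have hdet := (Matrix.isUnit_iff_isUnit_det D).1 hD
  have hJD' : J * D⁻¹ = D⁻¹ * J := by
    calc J * D⁻¹ = D⁻¹ * (D * J) * D⁻¹ := by
          rw [Matrix.nonsing_inv_mul_cancel_left _ _ hdet]
      _ = D⁻¹ * J := by
          rw [← hJD, ← Matrix.mul_assoc, Matrix.mul_nonsing_inv_cancel_right _ _ hdet]
  have hzero : A * D⁻¹ * A = 0 := by
    have h : A * D⁻¹ * A = -(A * D⁻¹ * A) := by
      calc A * D⁻¹ * A = A * (J * D⁻¹) * A := by rw [← Matrix.mul_assoc, hAJ]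
        _ = A * D⁻¹ * (J * A) := by rw [hJD']; simp only [Matrix.mul_assoc]
        _ = -(A * D⁻¹ * A) := by rw [hJA, Matrix.mul_neg]
    ext i j
    exact self_eq_neg.1 (congrFun (congrFun h i) j)
  refine Matrix.inv_eq_right_inv ?_
  have hDD := Matrix.mul_nonsing_inv D hdet
  calc (D + A) * (D⁻¹ - D⁻¹ * A * D⁻¹)
      = D * D⁻¹ - (D * D⁻¹) * A * D⁻¹ + A * D⁻¹ - (A * D⁻¹ * A) * D⁻¹ := by
        noncomm_ring
    _ = 1 := by rw [hzero, hDD]; simp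

end Core

/-- The diagonal sign matrix with entry `(-1) ^ i` on the `i`-th diagonal block. -/
def paritySign (n m : ℕ) : Mat n m := diagonal fun p => (-1) ^ p.1.val

theorem paritySign_mul_self (n m : ℕ) : paritySign n m * paritySign n m = 1 := by
  rw [paritySign, diagonal_mul_diagonal, ← diagonal_one]
  congr 1
  ext p
  rw [← mul_pow]
  simp

section Blocks

variable {n m : ℕ}

theorem blockDiagPart_add_stair_parts {S : Mat n m} (htri : IsBlockTridiag S) :
    blockDiagPart S + ((stairL S - blockDiagPart S) + (stairR S - blockDiagPart S)) = S := by
  ext p q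
  have h0 : (p.1.val + 1 < q.1.val ∨ q.1.val + 1 < p.1.val) → S p q = 0 := fun h =>
    congrFun (congrFun (htri p.1 q.1 h) p.2) q.2
  simp only [Matrix.add_apply, Matrix.sub_apply, blockDiagPart, stairL, stairR, Fin.ext_iff,
    ← Nat.not_even_iff_odd]
  split_ifs <;> first | (rw [h0 (by grind)]; simp) | simp

theorem paritySign_comm_blockDiagPart (S : Mat n m) :
    paritySign n m * blockDiagPart S = blockDiagPart S * paritySign n m := by
  ext p q
  simp only [paritySign, diagonal_mul, mul_diagonal, blockDiagPart]
  split_ifs with h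
  · rw [h, mul_comm]
  · simp

theorem paritySign_mul_stairL_part (S : Mat n m) :
    paritySign n m * (stairL S - blockDiagPart S) = -(stairL S - blockDiagPart S) := by
  ext p q
  simp only [paritySign, diagonal_mul, Matrix.sub_apply, Matrix.neg_apply, blockDiagPart, stairL]
  rcases Nat.even_or_odd p.1.val with h | h
  · simp [h, ← Nat.not_even_iff_odd]
  · simp [h.neg_one_pow]

theorem stairL_part_mul_paritySign (S : Mat n m) :
    (stairL S - blockDiagPart S) * paritySign n m = stairL S - blockDiagPart S := by
  ext p q
  simp only [paritySign, mul_diagonal, Matrix.sub_apply, blockDiagPart, stairL]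
  rcases Nat.even_or_odd q.1.val with h | h
  · simp [h.neg_one_pow]
  · have : ¬ (Odd p.1.val ∧ (p.1.val = q.1.val + 1 ∨ q.1.val = p.1.val + 1)) := by grind
    simp [this]

theorem paritySign_mul_stairR_part (S : Mat n m) :
    paritySign n m * (stairR S - blockDiagPart S) = stairR S - blockDiagPart S := by
  ext p q
  simp only [paritySign, diagonal_mul, Matrix.sub_apply, blockDiagPart, stairR]
  rcases Nat.even_or_odd p.1.val with h | h
  · simp [h.neg_one_pow]
  · simp [← Nat.not_odd_iff_even, h]

theorem stairR_part_mul_paritySign (S : Mat n m) :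
    (stairR S - blockDiagPart S) * paritySign n m = -(stairR S - blockDiagPart S) := by
  ext p q
  simp only [paritySign, mul_diagonal, Matrix.sub_apply, Matrix.neg_apply, blockDiagPart, stairR]
  rcases Nat.even_or_odd q.1.val with h | h
  · have : ¬ (Even p.1.val ∧ (p.1.val = q.1.val + 1 ∨ q.1.val = p.1.val + 1)) := by grind
    simp [this]
  · simp [h.neg_one_pow]

end Blocks

/-- If S is symmetric block tridiagonal positive definite, then every complex
eigenvalue of Φadd⁻¹ * S is real and lies in (0, 9/8]. -/
theorem add_eigenvalues_in_interval {n m : ℕ} (hn : 0 < n) (hm : 0 < m)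
    (S : Mat n m) (htri : IsBlockTridiag S) (hpd : S.PosDef) :
    ∀ μ : ℂ, (Matrix.charpoly ((Phiadd S * S).map (fun x => (x : ℂ)))).IsRoot μ →
      μ.im = 0 ∧ 0 < μ.re ∧ μ.re ≤ 9 / 8 := by
  intro μ hμ
  rw [← Matrix.mem_spectrum_iff_isRoot_charpoly] at hμ
  set D := blockDiagPart S with hD
  set A := stairL S - D with hA
  set B := stairR S - D with hB
  set J := paritySign n m with hJ
  have hS : D + (A + B) = S := blockDiagPart_add_stair_parts htri
  have hJJ : J * J = 1 := paritySign_mul_self n m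
  have hJD : J * D = D * J := paritySign_comm_blockDiagPart S
  have hJA : J * A = -A := paritySign_mul_stairL_part S
  have hAJ : A * J = A := stairL_part_mul_paritySign S
  have hJB : J * B = B := paritySign_mul_stairR_part S
  have hBJ : B * J = -B := stairR_part_mul_paritySign S
  have hflip : Jᴴ * S * J = D - (A + B) := by
    have hJH : Jᴴ = J := by
      rw [hJ, paritySign, diagonal_conjTranspose]
      exact congrArg diagonal (funext fun p => star_trivial _)
    rw [hJH, ← hS, mul_add, mul_add, hJD, hJA, hJB, add_mul, add_mul, Matrix.mul_assoc, hJJ,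
      neg_mul, hAJ, hBJ]
    simp only [mul_one]
    abel
  have hadd : (D + (A + B)).PosDef := hS ▸ hpd
  have hsub : (D - (A + B)).PosDef := by
    rw [← hflip]
    exact hpd.conjTranspose_mul_mul_same
      (Matrix.mulVec_injective_of_isUnit ⟨⟨J, J, hJJ, hJJ⟩, rfl⟩)
  have hDu : IsUnit D := by
    have h2 : (D + (A + B)) + (D - (A + B)) = (2 : ℝ) • D := by module
    have h3 := ((hadd.add hsub).smul (show (0 : ℝ) < 1 / 2 by norm_num)).isUnit
    rw [h2, smul_smul] at h3
    simpa using h3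
  have hL : (stairL S)⁻¹ = D⁻¹ - D⁻¹ * A * D⁻¹ := by
    rw [← inv_add_of_parity hDu hJD hJA hAJ, hA, add_sub_cancel]
  have hR : (stairR S)⁻¹ = D⁻¹ - D⁻¹ * B * D⁻¹ := by
    rw [← inv_add_of_parity (J := -J) hDu (by rw [neg_mul, mul_neg, hJD])
      (by rw [neg_mul, hJB]) (by rw [mul_neg, hBJ, neg_neg]), hB, add_sub_cancel]
  have hprod : Phiadd S * S =
      (1 - (1 / 2 : ℝ) • (D⁻¹ * (A + B))) * (1 + D⁻¹ * (A + B)) := by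
    have hDD : D⁻¹ * D = 1 :=
      Matrix.nonsing_inv_mul D ((Matrix.isUnit_iff_isUnit_det D).1 hDu)
    have hPhi : Phiadd S = (1 - (1 / 2 : ℝ) • (D⁻¹ * (A + B))) * D⁻¹ := by
      rw [Phiadd, hL, hR, sub_mul, one_mul, Matrix.smul_mul, mul_add, add_mul]
      module
    have hDS : D⁻¹ * S = 1 + D⁻¹ * (A + B) := by
      rw [← hS, mul_add, hDD]
    rw [hPhi, Matrix.mul_assoc, hDS]
  rw [hprod] at hμ
  exact eigenvalue_quadratic_of_posDef hDu hadd hsub hμ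

end StairPrecond
end
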